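/- If a semitopology (Pnt, 𝒪) is 3-twined, then any three-element partition of Pnt contains a dense element: for all P₁, P₂, P₃ ⊆ Pnt that are pairwise disjoint with P₁ ∪ P₂ ∪ P₃ = Pnt, at least one of P₁, P₂, P₃ is dense. -/

import Mathlib

/-- A semitopology: a set of points together with a collection of open sets closed under
arbitrary unions (in particular the empty set is open) and containing the whole point set. -/
structure Semitopology (Pnt : Type*) where
  opens : Set (Set Pnt)
  sUnion_mem : ∀ C ⊆ opens, ⋃₀ C ∈ opens
  univ_mem : Set.univ ∈ opens

/-- A subset `P` is dense (w.r.t. a collection `opens` of open sets) when every nonempty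
open set intersects `P`. -/
def IsDense {Pnt : Type*} (opens : Set (Set Pnt)) (P : Set Pnt) : Prop :=
  ∀ O ∈ opens, O ≠ ∅ → (O ∩ P).Nonempty

/-- A subset `P` has a nonempty open interior when some nonempty open set is contained in `P`. -/
def Noi {Pnt : Type*} (opens : Set (Set Pnt)) (P : Set Pnt) : Prop :=
  ∃ O ∈ opens, O ≠ ∅ ∧ O ⊆ P

/-- A collection of open sets is n-twined when any n nonempty open sets have
nonempty intersection. -/
def Twined {Pnt : Type*} (opens : Set (Set Pnt)) (n : ℕ) : Prop :=
  ∀ Os : Fin n → Set Pnt, (∀ i, Os i ∈ opens ∧ Os i ≠ ∅) → (⋂ i, Os i).Nonempty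

/-- The open sets of the semitopology AllBut(N,f) on points {0,…,N−1}: the empty set
together with all subsets of cardinality at least N − f. -/
def allButOpens (N f : ℕ) : Set (Set (Fin N)) :=
  {O | O = ∅ ∨ N - f ≤ O.ncard}

/-- in a 3-twined semitopology, any three-element partition of the point set
contains a dense element. -/
theorem stmt19 {Pnt : Type*} (S : Semitopology Pnt) (h : Twined S.opens 3)
    (P₁ P₂ P₃ : Set Pnt)
    (h12 : P₁ ∩ P₂ = ∅) (h13 : P₁ ∩ P₃ = ∅) (h23 : P₂ ∩ P₃ = ∅)
    (hunion : P₁ ∪ P₂ ∪ P₃ = Set.univ) :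
    IsDense S.opens P₁ ∨ IsDense S.opens P₂ ∨ IsDense S.opens P₃ := by
  by_contra hcon
  unfold IsDense at hcon
  push Not at hcon
  obtain ⟨⟨A, hA, hA0, hA1⟩, ⟨B, hB, hB0, hB1⟩, ⟨C, hC, hC0, hC1⟩⟩ := hcon
  obtain ⟨x, hx⟩ := h ![A, B, C] (by
    intro i
    fin_cases i
    · exact ⟨hA, Set.nonempty_iff_ne_empty.mp (by simpa [Set.nonempty_iff_ne_empty] using hA0)⟩
    · exact ⟨hB, Set.nonempty_iff_ne_empty.mp (by simpa [Set.nonempty_iff_ne_empty] using hB0)⟩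
    · exact ⟨hC, Set.nonempty_iff_ne_empty.mp (by simpa [Set.nonempty_iff_ne_empty] using hC0)⟩)
  rw [Set.mem_iInter] at hx
  have xA : x ∈ A := hx 0
  have xB : x ∈ B := hx 1
  have xC : x ∈ C := hx 2
  have hxu : x ∈ P₁ ∪ P₂ ∪ P₃ := hunion ▸ Set.mem_univ x
  rcases hxu with (h1 | h2) | h3
  · exact Set.eq_empty_iff_forall_notMem.mp hA1 x ⟨xA, h1⟩
  · exact Set.eq_empty_iff_forall_notMem.mp hB1 x ⟨xB, h2⟩
  · exact Set.eq_empty_iff_forall_notMem.mp hC1 x ⟨xC, h3⟩
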